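/- Let d ≥ 1, let 0 < p < d, and let X_1, …, X_n be independent rotationally invariant random vectors in ℝ^d. Then E|X_1 + … + X_n|^{-p} = κ_{p,d} ∫_0^∞ (∏_{k=1}^n E 𝔧_{d/2-1}(t|X_k|)) t^{p-1} dt, where κ_{p,d} = 2^{1-p} Γ((d-p)/2) / (Γ(d/2) Γ(p/2)), provided the integral on the right-hand side exists (is absolutely convergent). -/

import Mathlib

open MeasureTheory Real Set
open scoped ENNReal

/-- The normalized Bessel-type function
`𝔧_ν(t) = ∑_{k=0}^∞ (-1)^k / (k! (ν+1)_k) (t/2)^{2k}`, where `(x)_k`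
is the rising factorial `x(x+1)⋯(x+k-1)`. -/
noncomputable def jjB (ν t : ℝ) : ℝ :=
  ∑' k : ℕ, ((-1 : ℝ) ^ k / ((k.factorial : ℝ) * ∏ i ∈ Finset.range k, (ν + 1 + i))) *
    (t / 2) ^ (2 * k)

theorem Gamma_add_nat_eq_mul_prod {a : ℝ} (ha : 0 < a) (k : ℕ) :
    Real.Gamma (k + a) = Real.Gamma a * ∏ i ∈ Finset.range k, (a + i) := by
  induction k with
  | zero => simp
  | succ k ih =>
    have h : ((k + 1 : ℕ) : ℝ) + a = (k + a) + 1 := by push_cast; ring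
    rw [h, Real.Gamma_add_one (by positivity), ih, Finset.prod_range_succ]
    ring

theorem prod_half_add_mul_factorial (k : ℕ) :
    (∏ i ∈ Finset.range k, ((1 / 2 : ℝ) + i)) * (4 ^ k * k.factorial) = (2 * k).factorial := by
  induction k with
  | zero => simp
  | succ k ih =>
    have h : 2 * (k + 1) = 2 * k + 1 + 1 := by ring
    rw [h, Nat.factorial_succ, Nat.factorial_succ, Finset.prod_range_succ, Nat.factorial_succ]
    push_cast
    rw [← ih]
    ring

theorem integral_Ioi_pow_mul_exp_neg_sq (m : ℕ) :
    ∫ r in Ioi (0 : ℝ), r ^ m * exp (-r ^ 2) = Real.Gamma ((m + 1) / 2) / 2 := by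
  have h := integral_rpow_mul_exp_neg_rpow (p := 2) (q := m) (by norm_num)
    (by have : (0 : ℝ) ≤ m := by positivity
        linarith)
  simp only [Real.rpow_natCast, Real.rpow_two] at h
  rw [h]; ring

theorem integral_pow_two_mul_mul_exp_neg_sq (k : ℕ) :
    ∫ t : ℝ, t ^ (2 * k) * exp (-t ^ 2) = Real.Gamma (k + 1 / 2) := by
  have h := integral_comp_abs (f := fun t : ℝ => t ^ (2 * k) * exp (-t ^ 2))
  simp only [pow_mul, sq_abs] at h
  simp only [pow_mul]
  rw [h]
  simp only [← pow_mul]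
  rw [integral_Ioi_pow_mul_exp_neg_sq]
  push_cast
  rw [show ((2 * k + 1 : ℝ)) / 2 = k + 1 / 2 by ring]
  ring

/-- The orthogonal group acts transitively on spheres. -/
theorem exists_linearIsometryEquiv_apply_eq {E : Type*} [NormedAddCommGroup E]
    [InnerProductSpace ℝ E] {v w : E} (h : ‖v‖ = ‖w‖) : ∃ Q : E ≃ₗᵢ[ℝ] E, Q v = w :=
  ⟨_, Submodule.reflection_sub h⟩

theorem integral_inner_pow_mul_exp_neg_sq_norm (m k : ℕ) (y : EuclideanSpace ℝ (Fin (m + 1))) :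
    ∫ x : EuclideanSpace ℝ (Fin (m + 1)), inner ℝ x y ^ (2 * k) * exp (-‖x‖ ^ 2) =
      ‖y‖ ^ (2 * k) * (Real.Gamma (k + 1 / 2) * √π ^ m) := by
  obtain ⟨Q, hQ⟩ := exists_linearIsometryEquiv_apply_eq
    (v := EuclideanSpace.single (0 : Fin (m + 1)) ‖y‖) (w := y) (by simp)
  have h0 : ∀ t : ℝ, exp (-t ^ 2) = t ^ (2 * 0) * exp (-t ^ 2) := by simp
  have hone : ∫ t : ℝ, exp (-t ^ 2) = √π := by
    have := integral_pow_two_mul_mul_exp_neg_sq 0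
    simp only [← h0] at this
    rw [this]
    simpa using Real.Gamma_one_half_eq
  rw [← Q.measurePreserving.integral_comp Q.toHomeomorph.measurableEmbedding]
  have h1 : ∀ x : EuclideanSpace ℝ (Fin (m + 1)),
      inner ℝ (Q x) y ^ (2 * k) * exp (-‖Q x‖ ^ 2) =
      ‖y‖ ^ (2 * k) * ((x 0) ^ (2 * k) * exp (-‖x‖ ^ 2)) := by
    intro x
    rw [← hQ, Q.inner_map_map, Q.norm_map, Q.norm_map, EuclideanSpace.inner_single_right]
    simp [mul_pow, mul_assoc]
  simp only [h1]
  rw [integral_const_mul, ← (PiLp.volume_preserving_toLp (Fin (m + 1))).integral_comp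
    (MeasurableEquiv.toLp 2 _).measurableEmbedding]
  congr 1
  let f : Fin (m + 1) → ℝ → ℝ :=
    Fin.cons (fun t => t ^ (2 * k) * exp (-t ^ 2)) (fun _ t => exp (-t ^ 2))
  have h2 : ∀ x : Fin (m + 1) → ℝ,
      (WithLp.toLp 2 x) 0 ^ (2 * k) * exp (-‖WithLp.toLp 2 x‖ ^ 2) = ∏ i, f i (x i) := by
    intro x
    rw [EuclideanSpace.norm_sq_eq, ← Finset.sum_neg_distrib, exp_sum, Fin.prod_univ_succ,
      Fin.prod_univ_succ]
    simp [f, mul_assoc]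
  simp only [h2]
  rw [integral_fintype_prod_volume_eq_prod, Fin.prod_univ_succ]
  simp [f, integral_pow_two_mul_mul_exp_neg_sq, hone]

theorem integral_sphere_mul_radial {E : Type*} [NormedAddCommGroup E] [NormedSpace ℝ E]
    [MeasurableSpace E] [BorelSpace E] [FiniteDimensional ℝ E] [Nontrivial E] (μ : Measure E)
    [μ.IsAddHaarMeasure] (F : E → ℝ) (g : E → ℝ) (h : ℝ → ℝ)
    (hF : ∀ u : E, ‖u‖ = 1 → ∀ r : ℝ, 0 < r → F (r • u) = g u * h r) :
    ∫ x, F x ∂μ = (∫ u, g u ∂μ.toSphere) *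
      ∫ r in Ioi (0 : ℝ), r ^ (Module.finrank ℝ E - 1) * h r := by
  calc
    ∫ x, F x ∂μ = ∫ x : ({(0)}ᶜ : Set E), F x.1 ∂(μ.comap (↑)) := by
      rw [integral_subtype_comap (measurableSet_singleton _).compl F, restrict_compl_singleton]
    _ = ∫ x, g x.1 * h x.2 ∂μ.toSphere.prod (.volumeIoiPow (Module.finrank ℝ E - 1)) := by
      rw [← μ.measurePreserving_homeomorphUnitSphereProd.integral_comp
        (Homeomorph.measurableEmbedding _)]
      refine integral_congr_ae (.of_forall fun x => ?_)
      have hx : ‖(x : E)‖ ≠ 0 := norm_ne_zero_iff.2 x.2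
      simp only [homeomorphUnitSphereProd_apply_fst_coe, homeomorphUnitSphereProd_apply_snd_coe]
      rw [← hF _ (by simp [norm_smul, hx]) _ (lt_of_le_of_ne (norm_nonneg _) hx.symm), smul_smul,
        mul_inv_cancel₀ hx, one_smul]
    _ = (∫ u, g u ∂μ.toSphere) * ∫ x : Ioi (0 : ℝ), h x ∂.volumeIoiPow (Module.finrank ℝ E - 1) :=
      integral_prod_mul (fun u : Metric.sphere (0 : E) 1 => g u) (fun x : Ioi (0 : ℝ) => h x)
    _ = _ := by
      congr 1
      simp only [Measure.volumeIoiPow, ENNReal.ofReal]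
      rw [integral_withDensity_eq_integral_smul,
        integral_subtype_comap measurableSet_Ioi
          fun a ↦ Real.toNNReal (a ^ (Module.finrank ℝ E - 1)) • h a,
        setIntegral_congr_fun measurableSet_Ioi fun x hx ↦ ?_]
      · rw [NNReal.smul_def, Real.coe_toNNReal _ (pow_nonneg hx.out.le _), smul_eq_mul]
      · exact (measurable_subtype_coe.pow_const _).real_toNNReal

/-- Even moments of linear functionals with respect to the surface measure on the unit sphere. -/
theorem integral_sphere_inner_pow (m k : ℕ) (y : EuclideanSpace ℝ (Fin (m + 1))) :
    ∫ u : Metric.sphere (0 : EuclideanSpace ℝ (Fin (m + 1))) 1,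
        inner ℝ (u : EuclideanSpace ℝ _) y ^ (2 * k)
        ∂(volume : Measure (EuclideanSpace ℝ (Fin (m + 1)))).toSphere =
      2 * √π ^ m * Real.Gamma (k + 1 / 2) / Real.Gamma (k + (m + 1) / 2) * ‖y‖ ^ (2 * k) := by
  have h := integral_sphere_mul_radial (volume : Measure (EuclideanSpace ℝ (Fin (m + 1))))
    (fun x => inner ℝ x y ^ (2 * k) * exp (-‖x‖ ^ 2)) (fun u => inner ℝ u y ^ (2 * k))
    (fun r => r ^ (2 * k) * exp (-r ^ 2)) (by
      intro u hu r hr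
      simp [inner_smul_left, norm_smul, hu, mul_pow]
      ring)
  rw [integral_inner_pow_mul_exp_neg_sq_norm] at h
  simp only [finrank_euclideanSpace_fin, Nat.add_sub_cancel, ← mul_assoc, ← pow_add] at h
  rw [integral_Ioi_pow_mul_exp_neg_sq] at h
  push_cast at h
  rw [show ((m : ℝ) + 2 * k + 1) / 2 = k + (m + 1) / 2 by ring] at h
  have hG : 0 < Real.Gamma (k + ((m : ℝ) + 1) / 2) := Real.Gamma_pos_of_pos (by positivity)
  rw [div_mul_eq_mul_div, eq_div_iff hG.ne']
  linarith

theorem measureReal_toSphere_univ (m : ℕ) :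
    (volume : Measure (EuclideanSpace ℝ (Fin (m + 1)))).toSphere.real univ =
      2 * √π ^ (m + 1) / Real.Gamma (((m + 1 : ℕ) : ℝ) / 2) := by
  have h := integral_sphere_inner_pow m 0 0
  simp only [mul_zero, pow_zero, Nat.cast_zero, zero_add, Real.Gamma_one_half_eq, integral_const,
    smul_eq_mul, mul_one] at h
  rw [h]
  push_cast
  ring

/-- The Fourier transform of the surface measure on the unit sphere. -/
theorem integral_sphere_cos_inner (m : ℕ) (y : EuclideanSpace ℝ (Fin (m + 1))) :
    ∫ u : Metric.sphere (0 : EuclideanSpace ℝ (Fin (m + 1))) 1,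
        cos (inner ℝ (u : EuclideanSpace ℝ _) y)
        ∂(volume : Measure (EuclideanSpace ℝ (Fin (m + 1)))).toSphere =
      (volume : Measure (EuclideanSpace ℝ (Fin (m + 1)))).toSphere.real univ *
        jjB (((m + 1 : ℕ) : ℝ) / 2 - 1) ‖y‖ := by
  set σ := (volume : Measure (EuclideanSpace ℝ (Fin (m + 1)))).toSphere
  let F : ℕ → Metric.sphere (0 : EuclideanSpace ℝ (Fin (m + 1))) 1 → ℝ := fun k u =>
    (-1) ^ k * inner ℝ (u : EuclideanSpace ℝ _) y ^ (2 * k) / (2 * k).factorial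
  have hb : ∀ k u, ‖F k u‖ ≤ ‖y‖ ^ (2 * k) / (2 * k).factorial := by
    intro k u
    have hu : ‖(u : EuclideanSpace ℝ (Fin (m + 1)))‖ = 1 := by simp
    have h1 := abs_real_inner_le_norm (u : EuclideanSpace ℝ (Fin (m + 1))) y
    rw [hu, one_mul] at h1
    simp only [F, norm_div, norm_mul, norm_pow, norm_neg, norm_one, one_pow, one_mul,
      Real.norm_natCast]
    gcongr
    exact h1
  have hmeas : ∀ k, Continuous (F k) := fun k => by fun_prop
  have hFi : ∀ k, Integrable (F k) σ := fun k =>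
    Integrable.of_bound (hmeas k).aestronglyMeasurable _ (.of_forall (hb k))
  have hs : Summable fun k : ℕ => ‖y‖ ^ (2 * k) / ((2 * k).factorial : ℝ) :=
    (Real.summable_pow_div_factorial ‖y‖).comp_injective (i := fun k => 2 * k)
      (fun a b h => by simpa using h)
  have hsum : Summable fun k => ∫ u, ‖F k u‖ ∂σ := by
    refine .of_nonneg_of_le (fun k => integral_nonneg fun _ => norm_nonneg _) (fun k => ?_)
      (hs.mul_left (σ.real univ))
    calc ∫ u, ‖F k u‖ ∂σ ≤ ∫ _, ‖y‖ ^ (2 * k) / ((2 * k).factorial : ℝ) ∂σ :=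
          integral_mono (hFi k).norm (integrable_const _) (hb k)
      _ = _ := by simp
  have hmain := hasSum_integral_of_summable_integral_norm hFi hsum
  have hcos : ∀ u : Metric.sphere (0 : EuclideanSpace ℝ (Fin (m + 1))) 1,
      ∑' k, F k u = cos (inner ℝ (u : EuclideanSpace ℝ _) y) := fun u =>
    (Real.hasSum_cos _).tsum_eq
  simp only [hcos] at hmain
  rw [← hmain.tsum_eq, jjB, ← tsum_mul_left]
  congr 1
  ext k
  simp only [F]
  rw [integral_div, integral_const_mul, integral_sphere_inner_pow, measureReal_toSphere_univ,
    Gamma_add_nat_eq_mul_prod (by norm_num), Gamma_add_nat_eq_mul_prod (by positivity),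
    ← prod_half_add_mul_factorial k, Real.Gamma_one_half_eq]
  have e1 : ∏ i ∈ Finset.range k, (((m + 1 : ℕ) : ℝ) / 2 - 1 + 1 + i) =
      ∏ i ∈ Finset.range k, (((m : ℝ) + 1) / 2 + i) :=
    Finset.prod_congr rfl fun i _ => by push_cast; ring
  have p1 : 0 < ∏ i ∈ Finset.range k, (((m : ℝ) + 1) / 2 + i) :=
    Finset.prod_pos fun i _ => by positivity
  have p2 : 0 < ∏ i ∈ Finset.range k, ((1 / 2 : ℝ) + i) :=
    Finset.prod_pos fun i _ => by positivity
  have hG : 0 < Real.Gamma (((m : ℝ) + 1) / 2) := Real.Gamma_pos_of_pos (by positivity)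
  rw [e1, div_pow, pow_mul 2 2 k, show (2 : ℝ) ^ 2 = 4 by norm_num, pow_succ √π m]
  push_cast
  field_simp

theorem integral_integral_swap_of_bounded {X Y : Type*} [TopologicalSpace X] [TopologicalSpace Y]
    [SecondCountableTopology X] [SecondCountableTopology Y]
    [MeasurableSpace X] [MeasurableSpace Y] [OpensMeasurableSpace X] [OpensMeasurableSpace Y]
    {μ : Measure X} {ν : Measure Y} [IsFiniteMeasure μ] [IsFiniteMeasure ν] (f : X → Y → ℝ)
    (hf : Continuous fun z : X × Y => f z.1 z.2) {C : ℝ} (hC : ∀ x y, |f x y| ≤ C) :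
    ∫ x, ∫ y, f x y ∂ν ∂μ = ∫ y, ∫ x, f x y ∂μ ∂ν :=
  integral_integral_swap <| Integrable.of_bound (f := Function.uncurry f)
    (hf : Continuous (Function.uncurry f)).aestronglyMeasurable C (.of_forall fun z => hC z.1 z.2)

theorem charFun_eq_integral_cos {E : Type*} [NormedAddCommGroup E] [InnerProductSpace ℝ E]
    [MeasurableSpace E] [BorelSpace E] [SecondCountableTopology E] (μ : Measure E)
    [IsFiniteMeasure μ] (hneg : μ.map (fun x => -x) = μ) (ξ : E) :
    charFun μ ξ = ((∫ x, cos (inner ℝ x ξ) ∂μ : ℝ) : ℂ) := by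
  have hc : Integrable (fun x => cos (inner ℝ x ξ)) μ :=
    Integrable.of_bound (by fun_prop : Continuous _).aestronglyMeasurable 1
      (.of_forall fun u => by simpa using abs_cos_le_one _)
  have hs : Integrable (fun x => sin (inner ℝ x ξ)) μ :=
    Integrable.of_bound (by fun_prop : Continuous _).aestronglyMeasurable 1
      (.of_forall fun u => by simpa using abs_sin_le_one _)
  have h0 : ∫ x, sin (inner ℝ x ξ) ∂μ = 0 := by
    have h1 : ∫ x, sin (inner ℝ x ξ) ∂μ = ∫ x, sin (inner ℝ (-x) ξ) ∂μ := by
      conv_lhs => rw [← hneg]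
      rw [integral_map (by fun_prop) (by fun_prop : Continuous _).aestronglyMeasurable]
    simp only [inner_neg_left, sin_neg, integral_neg] at h1
    linarith
  rw [charFun_apply]
  have h2 : ∀ x, Complex.exp (inner ℝ x ξ * Complex.I) =
      ((cos (inner ℝ x ξ) : ℝ) : ℂ) + ((sin (inner ℝ x ξ) : ℝ) : ℂ) * Complex.I := by
    intro x
    rw [Complex.exp_mul_I]
    simp
  simp only [h2]
  rw [integral_add hc.ofReal (hs.ofReal.mul_const _), integral_mul_const, integral_complex_ofReal,
    integral_complex_ofReal, h0]
  simp

/-- The characteristic function of a rotationally invariant law is a Bessel mixture. -/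
theorem charFun_eq_integral_jjB (d : ℕ) (hd : 1 ≤ d) (μ : Measure (EuclideanSpace ℝ (Fin d)))
    [IsFiniteMeasure μ]
    (hrot : ∀ Q : EuclideanSpace ℝ (Fin d) ≃ₗᵢ[ℝ] EuclideanSpace ℝ (Fin d), μ.map ⇑Q = μ)
    (ξ : EuclideanSpace ℝ (Fin d)) :
    charFun μ ξ = ((∫ x, jjB ((d : ℝ) / 2 - 1) (‖ξ‖ * ‖x‖) ∂μ : ℝ) : ℂ) := by
  obtain ⟨m, rfl⟩ : ∃ m, d = m + 1 := ⟨d - 1, by omega⟩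
  rw [charFun_eq_integral_cos μ (hrot (LinearIsometryEquiv.neg ℝ))]
  congr 1
  set σ := (volume : Measure (EuclideanSpace ℝ (Fin (m + 1)))).toSphere
  have hσ : σ.real univ ≠ 0 := by
    rw [measureReal_toSphere_univ]
    have hG : 0 < Real.Gamma (((m + 1 : ℕ) : ℝ) / 2) := Real.Gamma_pos_of_pos (by positivity)
    have := Real.pi_pos
    positivity
  have hu : ∀ u : Metric.sphere (0 : EuclideanSpace ℝ (Fin (m + 1))) 1,
      ∫ x, cos (inner ℝ (u : EuclideanSpace ℝ _) (‖ξ‖ • x)) ∂μ =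
        ∫ x, cos (inner ℝ x ξ) ∂μ := by
    intro u
    obtain ⟨Q, hQ⟩ := exists_linearIsometryEquiv_apply_eq
      (v := ‖ξ‖ • (u : EuclideanSpace ℝ (Fin (m + 1)))) (w := ξ) (by simp [norm_smul])
    conv_rhs => rw [← hrot Q]
    rw [integral_map Q.continuous.aemeasurable (by fun_prop : Continuous _).aestronglyMeasurable]
    refine integral_congr_ae (.of_forall fun x => ?_)
    simp only
    rw [← hQ, Q.inner_map_map, norm_map, inner_smul_right, inner_smul_right, real_inner_comm]
    simp [norm_smul]
  have hswap := integral_integral_swap_of_bounded (μ := σ) (ν := μ)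
    (fun (u : Metric.sphere (0 : EuclideanSpace ℝ (Fin (m + 1))) 1) x =>
      cos (inner ℝ (u : EuclideanSpace ℝ (Fin (m + 1))) (‖ξ‖ • x)))
    (by fun_prop) fun u x => abs_cos_le_one _
  simp only [hu, integral_const, smul_eq_mul] at hswap
  rw [← mul_right_inj' hσ, hswap, ← integral_const_mul]
  refine integral_congr_ae (.of_forall fun x => ?_)
  simp only
  rw [integral_sphere_cos_inner, norm_smul, norm_norm]

theorem integral_exp_neg_mul_sq_norm_mul_cos {E : Type*} [NormedAddCommGroup E]
    [InnerProductSpace ℝ E] [FiniteDimensional ℝ E] [MeasurableSpace E] [BorelSpace E]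
    {b : ℝ} (hb : 0 < b) (x : E) :
    ∫ ξ : E, exp (-b * ‖ξ‖ ^ 2) * cos (inner ℝ x ξ) =
      (π / b) ^ ((Module.finrank ℝ E : ℝ) / 2) * exp (-‖x‖ ^ 2 / (4 * b)) := by
  have hb' : 0 < (b : ℂ).re := by simpa
  have h := GaussianFourier.integral_cexp_neg_mul_sq_norm_add hb' Complex.I x
  have hi := GaussianFourier.integrable_cexp_neg_mul_sq_norm_add hb' Complex.I x
  have h1 : ∀ ξ : E, exp (-b * ‖ξ‖ ^ 2) * cos (inner ℝ x ξ) =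
      RCLike.re (Complex.exp (-b * ‖ξ‖ ^ 2 + Complex.I * inner ℝ x ξ)) := by
    intro ξ
    have e : (-b * ‖ξ‖ ^ 2 + Complex.I * inner ℝ x ξ : ℂ) =
      ((-b * ‖ξ‖ ^ 2 : ℝ) : ℂ) + (inner ℝ x ξ : ℝ) * Complex.I := by push_cast; ring
    rw [e, RCLike.re_eq_complex_re, Complex.exp_re, Complex.add_re, Complex.add_im,
      Complex.re_ofReal_mul, Complex.im_ofReal_mul]
    simp only [Complex.ofReal_re, Complex.ofReal_im, Complex.I_re, Complex.I_im, mul_zero,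
      mul_one, add_zero, zero_add]
  simp only [h1]
  rw [integral_re hi, h, RCLike.re_eq_complex_re]
  have e2 : ((π : ℂ) / b) ^ ((Module.finrank ℝ E : ℂ) / 2) *
      Complex.exp (Complex.I ^ 2 * ‖x‖ ^ 2 / (4 * b)) =
      (((π / b) ^ ((Module.finrank ℝ E : ℝ) / 2) * exp (-‖x‖ ^ 2 / (4 * b)) : ℝ) : ℂ) := by
    rw [Complex.ofReal_mul, Complex.ofReal_cpow (by have := Real.pi_pos; positivity),
      Complex.ofReal_exp, Complex.I_sq]
    push_cast
    ring_nf
  rw [e2, Complex.ofReal_re]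

/-- The Laplace transform of `‖x‖ ^ 2` in terms of a radial characteristic function. -/
theorem integral_exp_neg_sq_norm_div (m : ℕ) (ν : Measure (EuclideanSpace ℝ (Fin (m + 1))))
    [IsFiniteMeasure ν] (φ : ℝ → ℝ) (hφ : ∀ ξ, ∫ x, cos (inner ℝ x ξ) ∂ν = φ ‖ξ‖)
    {b : ℝ} (hb : 0 < b) :
    ∫ x, exp (-‖x‖ ^ 2 / (4 * b)) ∂ν =
      2 * b ^ (((m + 1 : ℕ) : ℝ) / 2) / Real.Gamma (((m + 1 : ℕ) : ℝ) / 2) *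
        ∫ r in Ioi (0 : ℝ), r ^ m * (exp (-b * r ^ 2) * φ r) := by
  have hgauss : Integrable fun ξ : EuclideanSpace ℝ (Fin (m + 1)) => exp (-b * ‖ξ‖ ^ 2) := by
    have := (GaussianFourier.integrable_cexp_neg_mul_sq_norm_add (V := EuclideanSpace ℝ (Fin (m + 1)))
      (b := b) (by simpa) 0 0).norm
    refine this.congr (.of_forall fun ξ => ?_)
    simp only [zero_mul, add_zero, Complex.norm_exp]
    norm_cast
  have hswap : ∫ ξ : EuclideanSpace ℝ (Fin (m + 1)), ∫ x,
      exp (-b * ‖ξ‖ ^ 2) * cos (inner ℝ x ξ) ∂ν =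
      ∫ x, (∫ ξ : EuclideanSpace ℝ (Fin (m + 1)),
        exp (-b * ‖ξ‖ ^ 2) * cos (inner ℝ x ξ)) ∂ν := by
    refine integral_integral_swap (f := fun (ξ x : EuclideanSpace ℝ (Fin (m + 1))) =>
      exp (-b * ‖ξ‖ ^ 2) * cos (inner ℝ x ξ)) ?_
    refine (hgauss.comp_fst ν).mono' (Continuous.aestronglyMeasurable ?_)
      (.of_forall fun z => ?_)
    · simp only [Function.uncurry_def]
      fun_prop
    · simp only [Function.uncurry, norm_mul, Real.norm_eq_abs, abs_exp]
      exact mul_le_of_le_one_right (exp_pos _).le (abs_cos_le_one _)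
  simp only [integral_exp_neg_mul_sq_norm_mul_cos hb, integral_const_mul, hφ,
    finrank_euclideanSpace_fin] at hswap
  have hrad := integral_sphere_mul_radial (volume : Measure (EuclideanSpace ℝ (Fin (m + 1))))
    (fun ξ => exp (-b * ‖ξ‖ ^ 2) * φ ‖ξ‖) (fun _ => 1)
    (fun r => exp (-b * r ^ 2) * φ r) (by
      intro u hu r hr
      simp [norm_smul, hu, abs_of_pos hr])
  rw [hrad, integral_const, smul_eq_mul, mul_one, measureReal_toSphere_univ,
    finrank_euclideanSpace_fin, Nat.add_sub_cancel] at hswap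
  have hπ := Real.pi_pos
  have e1 : √π ^ (m + 1) = π ^ (((m + 1 : ℕ) : ℝ) / 2) := by
    rw [Real.sqrt_eq_rpow, ← Real.rpow_natCast, ← Real.rpow_mul hπ.le]
    ring_nf
  have hG : 0 < Real.Gamma (((m + 1 : ℕ) : ℝ) / 2) := Real.Gamma_pos_of_pos (by positivity)
  have q1 : 0 < π ^ (((m + 1 : ℕ) : ℝ) / 2) := by positivity
  have q2 : 0 < b ^ (((m + 1 : ℕ) : ℝ) / 2) := by positivity
  rw [e1, Real.div_rpow hπ.le hb.le] at hswap
  field_simp at hswap ⊢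
  linarith

theorem integral_rpow_mul_exp_neg_div_Ioi {q c : ℝ} (hq : 0 < q) (hc : 0 ≤ c) :
    ∫ b in Ioi (0 : ℝ), b ^ (-q - 1) * exp (-c / b) = Real.Gamma q * c ^ (-q) := by
  rcases hc.eq_or_lt with rfl | hc
  · simp [setIntegral_Ioi_zero_rpow, Real.zero_rpow (neg_ne_zero.2 hq.ne')]
  · have h := integral_comp_rpow_Ioi (fun w => w ^ (q - 1) * exp (-(c * w)))
      (p := -1) (by norm_num)
    rw [integral_rpow_mul_exp_neg_mul_Ioi hq hc] at h
    rw [Real.rpow_neg hc.le, ← Real.inv_rpow hc.le, mul_comm, ← one_div, ← h]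
    refine setIntegral_congr_fun measurableSet_Ioi fun b hb => ?_
    have hb : 0 < b := hb
    simp only [smul_eq_mul]
    rw [← Real.rpow_mul hb.le, abs_neg, abs_one, one_mul, ← mul_assoc, ← Real.rpow_add hb,
      Real.rpow_neg_one]
    ring_nf

/-- Negative moments in terms of a radial characteristic function. -/
theorem integral_norm_rpow_neg (m : ℕ) {p : ℝ} (hp : 0 < p) (hpd : p < ((m + 1 : ℕ) : ℝ))
    (ν : Measure (EuclideanSpace ℝ (Fin (m + 1)))) [IsFiniteMeasure ν] (φ : ℝ → ℝ)
    (hφ : ∀ ξ, ∫ x, cos (inner ℝ x ξ) ∂ν = φ ‖ξ‖)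
    (hint : IntegrableOn (fun t => φ t * t ^ (p - 1)) (Ioi 0)) :
    ∫ x, ‖x‖ ^ (-p) ∂ν =
      (2 ^ (1 - p) * Real.Gamma ((((m + 1 : ℕ) : ℝ) - p) / 2) /
        (Real.Gamma (((m + 1 : ℕ) : ℝ) / 2) * Real.Gamma (p / 2))) *
        ∫ t in Ioi (0 : ℝ), φ t * t ^ (p - 1) := by
  set D : ℝ := ((m + 1 : ℕ) : ℝ) with hD
  set a : ℝ := (D - p) / 2 with ha
  have ha0 : 0 < a := by rw [ha]; linarith
  let H : ℝ × ℝ → ℝ := fun z =>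
    (φ z.1 * z.1 ^ (p - 1)) * (z.1 ^ (D - p) * (z.2 ^ (a - 1) * exp (-(z.1 ^ 2 * z.2))))
  have hK : ∀ r : ℝ, 0 < r →
      ∫ b in Ioi (0 : ℝ), r ^ (D - p) * (b ^ (a - 1) * exp (-(r ^ 2 * b))) = Real.Gamma a := by
    intro r hr
    rw [integral_const_mul, integral_rpow_mul_exp_neg_mul_Ioi ha0 (by positivity), ← mul_assoc,
      one_div, ← Real.rpow_two, ← Real.rpow_neg hr.le, ← Real.rpow_mul hr.le, ← Real.rpow_add hr]
    have : D - p + -2 * a = 0 := by rw [ha]; ring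
    rw [this, Real.rpow_zero, one_mul]
  have hHm : AEStronglyMeasurable H
      ((volume.restrict (Ioi (0 : ℝ))).prod (volume.restrict (Ioi (0 : ℝ)))) :=
    hint.1.comp_fst.mul (Measurable.aestronglyMeasurable (by fun_prop))
  have hH : Integrable H
      ((volume.restrict (Ioi (0 : ℝ))).prod (volume.restrict (Ioi (0 : ℝ)))) := by
    rw [integrable_prod_iff hHm]
    constructor
    · refine (ae_restrict_mem measurableSet_Ioi).mono fun r (hr : 0 < r) => ?_
      have h := integrableOn_rpow_mul_exp_neg_mul_rpow (p := 1) (s := a - 1) (b := r ^ 2)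
        (by linarith) one_pos (by positivity)
      refine ((h.const_mul (r ^ (D - p))).const_mul (φ r * r ^ (p - 1))).congr
        (.of_forall fun b => ?_)
      simp [H]
    · refine (hint.norm.mul_const (Real.Gamma a)).congr ?_
      refine (ae_restrict_mem measurableSet_Ioi).mono fun r (hr : 0 < r) => ?_
      simp only
      rw [← hK r hr, ← integral_const_mul]
      refine setIntegral_congr_fun measurableSet_Ioi fun b (hb : 0 < b) => ?_
      simp only [H]
      rw [norm_mul (φ r * _) (r ^ (D - p) * _), Real.norm_of_nonneg (r := r ^ (D - p) * _) (by positivity)]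
  have hHb : ∀ b : ℝ, 0 < b → b ^ (-(p / 2) - 1) * ∫ x, exp (-‖x‖ ^ 2 / (4 * b)) ∂ν =
      2 / Real.Gamma (D / 2) * ∫ r in Ioi (0 : ℝ), H (r, b) := by
    intro b hb
    rw [integral_exp_neg_sq_norm_div m ν φ hφ hb, ← hD, ← mul_assoc, ← integral_const_mul,
      ← integral_const_mul]
    refine setIntegral_congr_fun measurableSet_Ioi fun r (hr : 0 < r) => ?_
    simp only [H]
    have e1 : b ^ (a - 1) = b ^ (-(p / 2) - 1) * b ^ (D / 2) := by
      rw [← Real.rpow_add hb, ha]; ring_nf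
    have e2 : r ^ m = r ^ (p - 1) * r ^ (D - p) := by
      rw [← Real.rpow_add hr, ← Real.rpow_natCast, hD]
      push_cast
      ring_nf
    rw [e1, e2, neg_mul, mul_comm b]
    ring
  let F : EuclideanSpace ℝ (Fin (m + 1)) → ℝ → ℝ := fun x b =>
    b ^ (-(p / 2) - 1) * exp (-‖x‖ ^ 2 / (4 * b))
  have hFi : Integrable (Function.uncurry F) (ν.prod (volume.restrict (Ioi (0 : ℝ)))) := by
    have hFm : Measurable (Function.uncurry F) := by
      simp only [F, Function.uncurry_def]
      fun_prop
    rw [integrable_prod_iff' hFm.aestronglyMeasurable]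
    constructor
    · refine (ae_restrict_mem measurableSet_Ioi).mono fun b (hb : 0 < b) => ?_
      simp only [F, Function.uncurry]
      refine Integrable.const_mul (Integrable.of_bound
        (Measurable.aestronglyMeasurable (by fun_prop)) 1 (.of_forall fun x => ?_)) _
      rw [Real.norm_of_nonneg (exp_pos _).le, exp_le_one_iff, neg_div]
      exact neg_nonpos.2 (by positivity)
    · refine (hH.integral_prod_right.const_mul (2 / Real.Gamma (D / 2))).congr ?_
      refine (ae_restrict_mem measurableSet_Ioi).mono fun b (hb : 0 < b) => ?_
      simp only
      rw [← hHb b hb, ← integral_const_mul]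
      refine integral_congr_ae (.of_forall fun x => ?_)
      simp only [F, Function.uncurry]
      rw [Real.norm_of_nonneg (by positivity)]
  have hswap := integral_integral_swap hFi
  have hleft : ∀ x : EuclideanSpace ℝ (Fin (m + 1)), ∫ b in Ioi (0 : ℝ), F x b =
      Real.Gamma (p / 2) * 2 ^ p * ‖x‖ ^ (-p) := by
    intro x
    have h := integral_rpow_mul_exp_neg_div_Ioi (q := p / 2) (c := ‖x‖ ^ 2 / 4) (by positivity)
      (by positivity)
    have e : (‖x‖ ^ 2 / 4) ^ (-(p / 2)) = 2 ^ p * ‖x‖ ^ (-p) := by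
      rw [show ‖x‖ ^ 2 / 4 = (‖x‖ / 2) ^ (2 : ℝ) by rw [Real.rpow_two]; ring,
        ← Real.rpow_mul (by positivity), show 2 * -(p / 2) = -p by ring,
        Real.div_rpow (norm_nonneg _) (by norm_num), Real.rpow_neg (by norm_num : (0 : ℝ) ≤ 2),
        div_inv_eq_mul, mul_comm]
    rw [mul_assoc, ← e, ← h]
    refine setIntegral_congr_fun measurableSet_Ioi fun b (hb : 0 < b) => ?_
    simp only [F]
    congr 2
    field_simp
  have hright : ∫ b in Ioi (0 : ℝ), ∫ x, F x b ∂ν =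
      2 / Real.Gamma (D / 2) * (Real.Gamma a * ∫ t in Ioi (0 : ℝ), φ t * t ^ (p - 1)) := by
    have h1 : ∫ b in Ioi (0 : ℝ), ∫ x, F x b ∂ν =
        ∫ b in Ioi (0 : ℝ), 2 / Real.Gamma (D / 2) * ∫ r in Ioi (0 : ℝ), H (r, b) := by
      refine setIntegral_congr_fun measurableSet_Ioi fun b (hb : 0 < b) => ?_
      simp only [F]
      rw [← hHb b hb, integral_const_mul]
    rw [h1, integral_const_mul, ← integral_integral_swap (f := fun r b => H (r, b)) hH]
    congr 1
    rw [← integral_const_mul]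
    refine setIntegral_congr_fun measurableSet_Ioi fun r (hr : 0 < r) => ?_
    simp only [H]
    rw [integral_const_mul, hK r hr, mul_comm]
  simp only [hleft, integral_const_mul] at hswap
  rw [hright] at hswap
  have hG1 : 0 < Real.Gamma (D / 2) := Real.Gamma_pos_of_pos (by rw [hD]; positivity)
  have hG2 : 0 < Real.Gamma (p / 2) := Real.Gamma_pos_of_pos (by positivity)
  have h2p : (0 : ℝ) < 2 ^ p := by positivity
  rw [Real.rpow_sub (by norm_num), Real.rpow_one]
  field_simp at hswap ⊢
  linarith

theorem integral_cos_inner_eq_re_charFun {E : Type*} [NormedAddCommGroup E]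
    [InnerProductSpace ℝ E] [MeasurableSpace E] [BorelSpace E] [SecondCountableTopology E]
    (μ : Measure E) [IsFiniteMeasure μ] (ξ : E) :
    ∫ x, cos (inner ℝ x ξ) ∂μ = (charFun μ ξ).re := by
  have hi : Integrable (fun x : E => Complex.exp (inner ℝ x ξ * Complex.I)) μ :=
    Integrable.of_bound (by fun_prop : Continuous _).aestronglyMeasurable 1
      (.of_forall fun x => (Complex.norm_exp_ofReal_mul_I _).le)
  rw [charFun_apply, ← RCLike.re_eq_complex_re, ← integral_re hi]
  simp only [RCLike.re_eq_complex_re, Complex.exp_ofReal_mul_I_re]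

/-- Fourier representation of negative moments: for independent rotationally
invariant random vectors `X₁, …, Xₙ` in `ℝ^d` and `0 < p < d`,
`E|∑ Xₖ|^{-p} = κ_{p,d} ∫_0^∞ (∏ₖ E 𝔧_{d/2-1}(t|Xₖ|)) t^{p-1} dt`,
provided the right-hand integral is absolutely convergent. -/
theorem neg_moment_fourier_representation
    (d : ℕ) (hd : 1 ≤ d) (p : ℝ) (hp : 0 < p) (hpd : p < d)
    (n : ℕ) (hn : 1 ≤ n) (μ : Fin n → Measure (EuclideanSpace ℝ (Fin d)))
    [∀ k, IsProbabilityMeasure (μ k)]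
    (hrot : ∀ k, ∀ Q : EuclideanSpace ℝ (Fin d) ≃ₗᵢ[ℝ] EuclideanSpace ℝ (Fin d),
      (μ k).map ⇑Q = μ k)
    (hint : IntegrableOn
      (fun t : ℝ => (∏ k, ∫ x, jjB ((d : ℝ) / 2 - 1) (t * ‖x‖) ∂(μ k)) * t ^ (p - 1))
      (Set.Ioi 0)) :
    ∫ x, ‖∑ k, x k‖ ^ (-p) ∂(Measure.pi μ)
      = (2 ^ (1 - p) * Real.Gamma (((d : ℝ) - p) / 2) /
          (Real.Gamma ((d : ℝ) / 2) * Real.Gamma (p / 2))) *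
        ∫ t in Set.Ioi (0 : ℝ),
          (∏ k, ∫ x, jjB ((d : ℝ) / 2 - 1) (t * ‖x‖) ∂(μ k)) * t ^ (p - 1) := by
  obtain ⟨m, rfl⟩ : ∃ m, d = m + 1 := ⟨d - 1, by omega⟩
  have hmeas : Measurable fun x : Fin n → EuclideanSpace ℝ (Fin (m + 1)) => ∑ k, x k := by
    fun_prop
  have := Measure.isProbabilityMeasure_map (μ := Measure.pi μ) hmeas.aemeasurable
  have hchar : ∀ ξ, charFun ((Measure.pi μ).map fun x => ∑ k, x k) ξ =
      ((∏ k, ∫ x, jjB (((m + 1 : ℕ) : ℝ) / 2 - 1) (‖ξ‖ * ‖x‖) ∂(μ k) : ℝ) : ℂ) := by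
    intro ξ
    rw [ProbabilityTheory.charFun_map_sum_pi_eq_prod, Finset.prod_apply, Complex.ofReal_prod]
    exact Finset.prod_congr rfl fun k _ => charFun_eq_integral_jjB _ hd (μ k) (hrot k) ξ
  rw [← integral_norm_rpow_neg m hp hpd ((Measure.pi μ).map fun x => ∑ k, x k) _ ?_ hint,
    integral_map hmeas.aemeasurable (Measurable.aestronglyMeasurable (by fun_prop))]
  intro ξ
  have h := integral_cos_inner_eq_re_charFun ((Measure.pi μ).map fun x => ∑ k, x k) ξ
  rw [h, hchar, Complex.ofReal_re]
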